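/- Assume (v, Xv, …, X^{r−1}v) is a basis of E, each functional v*∘X^j (0 ≤ j ≤ r−1) vanishes on W, and the restrictions to E of v*, v*∘X, …, v*∘X^{r−1} form a basis of E*. Set x₁₁ := π_W ∘ X restricted to W (an endomorphism of W), u := π_W(X^r v) ∈ W, and u* := the restriction of v*∘X^r to W (an element of W*). Then (X, v, v*) is regular for V (of dimension n) if and only if (x₁₁, u, u*) is regular for W (of dimension n − r). -/

import Mathlib

/-- `(Y, u, u*)` is a *regular* triple for an `m`-dimensional space `U`:
`(u, Yu, …, Y^{m−1}u)` is a basis of `U` and `(u*, u*∘Y, …, u*∘Y^{m−1})` is a basis of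
the dual space `U*`. -/
def RegularTriple (F : Type*) {U : Type*} [Field F] [AddCommGroup U] [Module F U]
    (m : ℕ) (Y : U →ₗ[F] U) (u : U) (us : Module.Dual F U) : Prop :=
  (LinearIndependent F (fun i : Fin m => (Y ^ (i : ℕ)) u) ∧
    Submodule.span F (Set.range fun i : Fin m => (Y ^ (i : ℕ)) u) = ⊤) ∧
  (LinearIndependent F (fun i : Fin m => (us ∘ₗ Y ^ (i : ℕ) : Module.Dual F U)) ∧
    Submodule.span F (Set.range fun i : Fin m => (us ∘ₗ Y ^ (i : ℕ) : Module.Dual F U)) = ⊤)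

/-- The span of the first `m` vectors of the orbit of `v` under `X`. -/
def orbitSpan (F : Type*) {U : Type*} [Field F] [AddCommGroup U] [Module F U]
    (m : ℕ) (X : U →ₗ[F] U) (v : U) : Submodule F U :=
  Submodule.span F (Set.range fun i : Fin m => (X ^ (i : ℕ)) v)

section OrbitSpan

variable {F U V : Type*} [Field F] [AddCommGroup U] [Module F U] [AddCommGroup V] [Module F V]

lemma pow_apply_mem_orbitSpan {m i : ℕ} (h : i < m) (X : U →ₗ[F] U) (v : U) :
    (X ^ i) v ∈ orbitSpan F m X v :=
  Submodule.subset_span ⟨⟨i, h⟩, rfl⟩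

lemma orbitSpan_le_iff {m : ℕ} {X : U →ₗ[F] U} {v : U} {S : Submodule F U} :
    orbitSpan F m X v ≤ S ↔ ∀ i < m, (X ^ i) v ∈ S := by
  rw [orbitSpan, Submodule.span_le, Set.range_subset_iff, Fin.forall_iff]
  rfl

lemma orbitSpan_mono {m k : ℕ} (h : m ≤ k) (X : U →ₗ[F] U) (v : U) :
    orbitSpan F m X v ≤ orbitSpan F k X v :=
  orbitSpan_le_iff.2 fun _ hi => pow_apply_mem_orbitSpan (hi.trans_le h) X v

lemma apply_mem_orbitSpan_succ {m : ℕ} {X : U →ₗ[F] U} {v y : U}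
    (hy : y ∈ orbitSpan F m X v) : X y ∈ orbitSpan F (m + 1) X v := by
  have h : orbitSpan F m X v ≤ (orbitSpan F (m + 1) X v).comap X :=
    orbitSpan_le_iff.2 fun i hi => by
      rw [Submodule.mem_comap, ← Module.End.mul_apply, ← pow_succ']
      exact pow_apply_mem_orbitSpan (by omega) X v
  exact h hy

/-- If `p` intertwines `X` and `Y` up to multiples of `p (X ^ r v)`, then it sends
`X ^ (r + k) v` to `Y ^ k (p (X ^ r v))` up to lower terms of the orbit. -/
lemma map_pow_sub_pow_mem_orbitSpan {r : ℕ} {X : V →ₗ[F] V} {v : V} {Y : U →ₗ[F] U}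
    {p : V →ₗ[F] U} (h : ∀ y, p (X y) - Y (p y) ∈ Submodule.span F {p ((X ^ r) v)}) (k : ℕ) :
    p ((X ^ (r + k)) v) - (Y ^ k) (p ((X ^ r) v)) ∈ orbitSpan F k Y (p ((X ^ r) v)) := by
  induction k with
  | zero => simp
  | succ k ih =>
    have h₁ : Submodule.span F {p ((X ^ r) v)} ≤ orbitSpan F (k + 1) Y (p ((X ^ r) v)) := by
      rw [Submodule.span_singleton_le_iff_mem]
      simpa using pow_apply_mem_orbitSpan k.succ_pos Y (p ((X ^ r) v))
    have h₂ := add_mem (h₁ (h ((X ^ (r + k)) v))) (apply_mem_orbitSpan_succ ih)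
    rw [← add_assoc, pow_succ', pow_succ', Module.End.mul_apply, Module.End.mul_apply]
    simpa using h₂

lemma map_orbitSpan_add {r : ℕ} {X : V →ₗ[F] V} {v : V} {Y : U →ₗ[F] U} {p : V →ₗ[F] U}
    (h : ∀ y, p (X y) - Y (p y) ∈ Submodule.span F {p ((X ^ r) v)})
    (hker : LinearMap.ker p = orbitSpan F r X v) (k : ℕ) :
    (orbitSpan F (r + k) X v).map p = orbitSpan F k Y (p ((X ^ r) v)) := by
  apply le_antisymm
  · rw [Submodule.map_le_iff_le_comap, orbitSpan_le_iff]
    intro i hi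
    rw [Submodule.mem_comap]
    rcases lt_or_ge i r with hir | hir
    · have : (X ^ i) v ∈ LinearMap.ker p := hker ▸ pow_apply_mem_orbitSpan hir X v
      rw [LinearMap.mem_ker.1 this]
      exact zero_mem _
    · obtain ⟨j, rfl⟩ := Nat.exists_eq_add_of_le hir
      have hj : j < k := by omega
      exact (Submodule.sub_mem_iff_left _ (pow_apply_mem_orbitSpan hj Y _)).1
        (orbitSpan_mono hj.le _ _ (map_pow_sub_pow_mem_orbitSpan h j))
  · induction k with
    | zero => exact orbitSpan_le_iff.2 fun i hi => absurd hi i.not_lt_zero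
    | succ k ih =>
      have hmono := ih.trans
        (Submodule.map_mono (orbitSpan_mono (by omega : r + k ≤ r + (k + 1)) X v))
      refine orbitSpan_le_iff.2 fun i hi => ?_
      rcases Nat.lt_succ_iff_lt_or_eq.1 hi with hik | rfl
      · exact hmono (pow_apply_mem_orbitSpan hik _ _)
      · exact (Submodule.sub_mem_iff_right _ (Submodule.mem_map_of_mem
          (pow_apply_mem_orbitSpan (by omega) X v))).1 (hmono (map_pow_sub_pow_mem_orbitSpan h i))

/-- Cyclicity of `v` for `X` descends to, and lifts from, the quotient by the span of an initial
segment of its orbit. -/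
lemma orbitSpan_eq_top_iff {n r : ℕ} (hrn : r ≤ n) {X : V →ₗ[F] V} {v : V} {Y : U →ₗ[F] U}
    {p : V →ₗ[F] U} (h : ∀ y, p (X y) - Y (p y) ∈ Submodule.span F {p ((X ^ r) v)})
    (hker : LinearMap.ker p = orbitSpan F r X v) (hp : Function.Surjective p) :
    orbitSpan F n X v = ⊤ ↔ orbitSpan F (n - r) Y (p ((X ^ r) v)) = ⊤ := by
  have hle : LinearMap.ker p ≤ orbitSpan F n X v := hker ▸ orbitSpan_mono hrn X v
  rw [← map_orbitSpan_add h hker, Nat.add_sub_cancel' hrn]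
  constructor
  · intro ht
    rw [ht, Submodule.map_top, LinearMap.range_eq_top.2 hp]
  · intro ht
    rw [← Submodule.comap_map_eq_self hle, ht, Submodule.comap_top]

lemma dualMap_pow_apply (X : U →ₗ[F] U) (i : ℕ) (f : Module.Dual F U) :
    (X.dualMap ^ i) f = f ∘ₗ X ^ i := by
  induction i with
  | zero => rfl
  | succ i ih =>
    rw [pow_succ', Module.End.mul_apply, ih, pow_succ]
    rfl

/-- When `m` is the dimension, linear independence is automatic in a regular triple. -/
lemma regularTriple_iff_orbitSpan [FiniteDimensional F U] {m : ℕ} (hm : Module.finrank F U = m)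
    (Y : U →ₗ[F] U) (u : U) (us : Module.Dual F U) :
    RegularTriple F m Y u us ↔
      orbitSpan F m Y u = ⊤ ∧ orbitSpan F m Y.dualMap us = ⊤ := by
  simp only [RegularTriple, orbitSpan, dualMap_pow_apply]
  refine and_congr (and_iff_right_of_imp fun h => ?_) (and_iff_right_of_imp fun h => ?_)
  · exact linearIndependent_of_top_le_span_of_card_eq_finrank h.ge (by simp [hm])
  · exact linearIndependent_of_top_le_span_of_card_eq_finrank h.ge
      (by simp [hm, Subspace.dual_finrank_eq])

/-- The compression of `X` to `W` along `E` intertwines with `X` up to `π_W (X ^ r v)`. -/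
lemma projectionOnto_apply_sub_mem_span {r : ℕ} {W E : Submodule F V} (hWE : IsCompl W E)
    {X : V →ₗ[F] V} {v : V} (hE : orbitSpan F r X v = E) (y : V) :
    W.projectionOnto E hWE (X y) -
        ((W.projectionOnto E hWE ∘ₗ X) ∘ₗ W.subtype) (W.projectionOnto E hWE y) ∈
      Submodule.span F {W.projectionOnto E hWE ((X ^ r) v)} := by
  set p := W.projectionOnto E hWE
  have hle : orbitSpan F r X v ≤ (Submodule.span F {p ((X ^ r) v)}).comap (p ∘ₗ X) := by
    refine orbitSpan_le_iff.2 fun i hi => ?_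
    rw [Submodule.mem_comap, LinearMap.comp_apply, ← Module.End.mul_apply, ← pow_succ']
    rcases (Nat.succ_le_of_lt hi).lt_or_eq with h | h
    · have hmem : (X ^ (i + 1)) v ∈ E := hE ▸ pow_apply_mem_orbitSpan h X v
      rw [(Submodule.projectionOnto_apply_eq_zero_iff hWE).2 hmem]
      exact zero_mem _
    · rw [show i + 1 = r from h]
      exact Submodule.mem_span_singleton_self _
  have hmem : y - (p y : V) ∈ E := by
    rw [← Submodule.projectionOnto_apply_eq_zero_iff hWE, map_sub,
      Submodule.projectionOnto_apply_left, sub_self]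
  rw [← hE] at hmem
  simpa using hle hmem

/-- The dual counterpart of `projectionOnto_apply_sub_mem_span`, for restriction of functionals
to `W`. -/
lemma dualRestrict_apply_sub_mem_span {r : ℕ} {W E : Submodule F V} (hWE : IsCompl W E)
    {X : V →ₗ[F] V} {f : Module.Dual F V}
    (hvanish : ∀ i < r, ∀ w ∈ W, f ((X ^ i) w) = 0)
    (hE : (orbitSpan F r X.dualMap f).map E.dualRestrict = ⊤) (g : Module.Dual F V) :
    W.dualRestrict (X.dualMap g) -
        ((W.projectionOnto E hWE ∘ₗ X) ∘ₗ W.subtype).dualMap (W.dualRestrict g) ∈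
      Submodule.span F {W.dualRestrict ((X.dualMap ^ r) f)} := by
  set Y := (W.projectionOnto E hWE ∘ₗ X) ∘ₗ W.subtype
  set D : Module.Dual F V →ₗ[F] Module.Dual F W :=
    W.dualRestrict ∘ₗ X.dualMap - Y.dualMap ∘ₗ W.dualRestrict
  have hD (g : Module.Dual F V) (w : W) : D g w = g (X w - (Y w : V)) := by
    simp [D]
  have hle : orbitSpan F r X.dualMap f ≤
      (Submodule.span F {W.dualRestrict ((X.dualMap ^ r) f)}).comap D := by
    refine orbitSpan_le_iff.2 fun i hi => ?_
    have hDi : D ((X.dualMap ^ i) f) = W.dualRestrict ((X.dualMap ^ (i + 1)) f) := by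
      ext w
      rw [hD, map_sub, dualMap_pow_apply, dualMap_pow_apply, LinearMap.comp_apply,
        LinearMap.comp_apply, hvanish i hi _ (Y w).2, sub_zero, pow_succ]
      rfl
    rw [Submodule.mem_comap, hDi]
    rcases (Nat.succ_le_of_lt hi).lt_or_eq with h | h
    · have hzero : W.dualRestrict ((X.dualMap ^ (i + 1)) f) = 0 := by
        ext w
        rw [dualMap_pow_apply]
        exact hvanish (i + 1) h w w.2
      rw [hzero]
      exact zero_mem _
    · rw [show i + 1 = r from h]
      exact Submodule.mem_span_singleton_self _
  obtain ⟨g', hg', hgg'⟩ : E.dualRestrict g ∈ (orbitSpan F r X.dualMap f).map E.dualRestrict :=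
    hE ▸ Submodule.mem_top
  have hDg : D g = D g' := by
    ext w
    have hmem : X w - (Y w : V) ∈ E := by
      rw [← Submodule.projectionOnto_apply_eq_zero_iff hWE, map_sub,
        Submodule.projectionOnto_apply_left]
      exact sub_self _
    rw [hD, hD]
    exact (LinearMap.congr_fun hgg' ⟨_, hmem⟩).symm
  change D g ∈ _
  rw [hDg]
  exact hle hg'

lemma ker_dualRestrict_eq_orbitSpan {r : ℕ} {W E : Submodule F V} (hWE : IsCompl W E)
    {X : V →ₗ[F] V} {f : Module.Dual F V}
    (hvanish : ∀ i < r, ∀ w ∈ W, f ((X ^ i) w) = 0)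
    (hE : (orbitSpan F r X.dualMap f).map E.dualRestrict = ⊤) :
    LinearMap.ker W.dualRestrict = orbitSpan F r X.dualMap f := by
  have hle : orbitSpan F r X.dualMap f ≤ LinearMap.ker W.dualRestrict := by
    refine orbitSpan_le_iff.2 fun i hi => ?_
    rw [LinearMap.mem_ker]
    ext w
    rw [dualMap_pow_apply]
    exact hvanish i hi w w.2
  refine le_antisymm (fun g hg => ?_) hle
  obtain ⟨g', hg', hgg'⟩ : E.dualRestrict g ∈ (orbitSpan F r X.dualMap f).map E.dualRestrict :=
    hE ▸ Submodule.mem_top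
  have hW : W.dualRestrict g = W.dualRestrict g' :=
    (LinearMap.mem_ker.1 hg).trans (LinearMap.mem_ker.1 (hle hg')).symm
  have hg_eq : g = g' := by
    ext y
    obtain ⟨w, hw, e, he, rfl⟩ :=
      Submodule.mem_sup.1 (hWE.sup_eq_top ▸ Submodule.mem_top : y ∈ W ⊔ E)
    rw [map_add, map_add]
    exact congr_arg₂ _ (LinearMap.congr_fun hW ⟨w, hw⟩) (LinearMap.congr_fun hgg' ⟨e, he⟩).symm
  exact hg_eq ▸ hg'

end OrbitSpan

/-- Let `V = W ⊕ E` with `dim V = n`, `dim E = r`, `1 ≤ r ≤ n`.  Assume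
`(v, Xv, …, X^{r−1}v)` is a basis of `E`, each `v*∘X^j` (`0 ≤ j ≤ r−1`) vanishes on `W`,
and the restrictions to `E` of `v*, v*∘X, …, v*∘X^{r−1}` form a basis of `E*`.  Set
`x₁₁ = π_W ∘ X |_W`, `u = π_W(X^r v)`, `u* = (v*∘X^r)|_W`.  Then `(X, v, v*)` is regular
for `V` iff `(x₁₁, u, u*)` is regular for `W` (of dimension `n − r`). -/
theorem statement7 {F V : Type*} [Field F] [AddCommGroup V] [Module F V]
    [FiniteDimensional F V] {n r : ℕ} (hr : 1 ≤ r) (hrn : r ≤ n)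
    (hdim : Module.finrank F V = n)
    (W E : Submodule F V) (hcompl : IsCompl W E) (hEdim : Module.finrank F E = r)
    (X : V →ₗ[F] V) (v : V) (vs : Module.Dual F V)
    (hbasisE : LinearIndependent F (fun i : Fin r => (X ^ (i : ℕ)) v) ∧
      Submodule.span F (Set.range fun i : Fin r => (X ^ (i : ℕ)) v) = E)
    (hvanish : ∀ i : Fin r, ∀ w ∈ W, vs ((X ^ (i : ℕ)) w) = 0)
    (hdualbasisE : LinearIndependent F
        (fun i : Fin r => (vs ∘ₗ X ^ (i : ℕ)).domRestrict E) ∧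
      Submodule.span F
        (Set.range fun i : Fin r => (vs ∘ₗ X ^ (i : ℕ)).domRestrict E) = ⊤) :
    RegularTriple F n X v vs ↔
      RegularTriple F (n - r)
        (((W.linearProjOfIsCompl E hcompl) ∘ₗ X) ∘ₗ W.subtype)
        (W.linearProjOfIsCompl E hcompl ((X ^ r) v))
        ((vs ∘ₗ X ^ r).domRestrict W) := by
  have hWdim : Module.finrank F W = n - r := by
    have := Submodule.finrank_add_eq_of_isCompl hcompl
    omega
  have hE : orbitSpan F r X v = E := hbasisE.2
  have hvan : ∀ i < r, ∀ w ∈ W, vs ((X ^ i) w) = 0 := fun i hi => hvanish ⟨i, hi⟩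
  have hdual : (orbitSpan F r X.dualMap vs).map E.dualRestrict = ⊤ := by
    rw [orbitSpan, Submodule.map_span, ← Set.range_comp, ← hdualbasisE.2]
    congr 2
    ext1 i
    rw [Function.comp_apply, dualMap_pow_apply]
    rfl
  have hres : (vs ∘ₗ X ^ r).domRestrict W = W.dualRestrict ((X.dualMap ^ r) vs) := by
    rw [dualMap_pow_apply]
    rfl
  rw [regularTriple_iff_orbitSpan hdim, regularTriple_iff_orbitSpan hWdim, hres]
  refine and_congr
    (orbitSpan_eq_top_iff hrn (projectionOnto_apply_sub_mem_span hcompl hE) ?_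
      (Submodule.projectionOnto_surjective hcompl))
    (orbitSpan_eq_top_iff hrn (dualRestrict_apply_sub_mem_span hcompl hvan hdual)
      (ker_dualRestrict_eq_orbitSpan hcompl hvan hdual) Subspace.dualRestrict_surjective)
  rw [hE]
  exact Submodule.ker_projectionOnto hcompl
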